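/- Let n >= 1 and let q be a prime power. Let pi be an n-dimensional projective subspace of PG(2n+1,q^2) and let mu be a generator of the Hermitian variety H(2n+1,q^2). Then the projective dimension of pi intersect mu equals the projective dimension of pi^sigma intersect mu (with projective dimension -1 for an empty intersection). -/

import Mathlib

open scoped BigOperators

namespace HermCode

/-- The Hermitian sesquilinear form `h(x,y) = ∑ᵢ xᵢ * yᵢ^q` on `F^m`. -/
def herm (q : ℕ) {F : Type} [Field F] {m : ℕ} (x y : Fin m → F) : F :=
  ∑ i, x i * (y i) ^ q

/-- For a fixed vector `x`, the linear map `y ↦ h(y,x)`. -/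
def hermL (q : ℕ) {F : Type} [Field F] {m : ℕ} (x : Fin m → F) :
    (Fin m → F) →ₗ[F] F where
  toFun y := herm q y x
  map_add' a b := by
    simp [herm, add_mul, Finset.sum_add_distrib]
  map_smul' c a := by
    simp [herm, Finset.mul_sum, mul_assoc]

/-- The image `W^σ` of a subspace `W` under the Hermitian polarity `σ`:
the subspace of all vectors orthogonal to every vector of `W`
with respect to the Hermitian form. -/
def polar (q : ℕ) {F : Type} [Field F] {m : ℕ} (W : Submodule F (Fin m → F)) :
    Submodule F (Fin m → F) :=
  ⨅ x : W, LinearMap.ker (hermL q (x : Fin m → F))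

/-- A subspace all of whose points lie on the Hermitian variety. -/
def TotallyIsotropic (q : ℕ) {F : Type} [Field F] {m : ℕ}
    (W : Submodule F (Fin m → F)) : Prop :=
  ∀ x ∈ W, herm q x x = 0

/-- A point of the Hermitian variety: a projective point (1-dimensional subspace)
spanned by an isotropic vector. -/
def IsHermPoint (q : ℕ) {F : Type} [Field F] {m : ℕ}
    (P : Submodule F (Fin m → F)) : Prop :=
  Module.finrank F P = 1 ∧ TotallyIsotropic q P

/-- A generator of `H(2n+1,q²)`: an `n`-dimensional projective subspace all of
whose points lie on the Hermitian variety. -/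
def IsGenerator (q n : ℕ) {F : Type} [Field F]
    (W : Submodule F (Fin (2*n+2) → F)) : Prop :=
  Module.finrank F W = n + 1 ∧ TotallyIsotropic q W

/-- A code word of the dual code `C_n(H(2n+1,q²))^⊥`: a function from points to `F_p`
(vanishing off the Hermitian variety) summing to zero over every generator. -/
def IsCodeword (p q n : ℕ) {F : Type} [Field F]
    (c : Submodule F (Fin (2*n+2) → F) → ZMod p) : Prop :=
  (∀ P, ¬ IsHermPoint q P → c P = 0) ∧
  ∀ μ, IsGenerator q n μ → (∑ᶠ P ∈ {P | IsHermPoint q P ∧ P ≤ μ}, c P) = 0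

/-- The (Hamming) weight of a code word. -/
noncomputable def wt {p : ℕ} {α : Type*} (c : α → ZMod p) : ℕ :=
  Nat.card {x : α // c x ≠ 0}

open scoped Classical in
/-- The incidence vector `v_π` of `π ∩ H`. -/
noncomputable def vsub (p q : ℕ) {F : Type} [Field F] {m : ℕ}
    (π : Submodule F (Fin m → F)) : Submodule F (Fin m → F) → ZMod p :=
  fun P => if IsHermPoint q P ∧ P ≤ π then 1 else 0

/-- `θ_m(q)`, the number of points of `PG(m,q)`. -/
noncomputable def theta (q : ℕ) (m : ℤ) : ℚ :=
  ((q:ℚ)^(m+1) - 1) / ((q:ℚ) - 1)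

/-- `μ_m(q²)`, the number of points of `H(m,q²)` (with `μ_{-1} = 0`). -/
noncomputable def muH (q : ℕ) (m : ℤ) : ℚ :=
  (((q:ℚ)^(m+1) - (-1:ℚ)^(m+1)) * ((q:ℚ)^m - (-1:ℚ)^m)) / ((q:ℚ)^2 - 1)

/-- The number `N(n,i)`. -/
noncomputable def NN (q n : ℕ) (i : ℤ) : ℚ :=
  (q:ℚ)^(((n:ℤ)-1)^2 - ((((n:ℤ)-i-1).toNat.choose 2 : ℕ) : ℤ)) *
    ∏ j ∈ Finset.range ((n:ℤ)-i-2).toNat, ((q:ℚ)^(j+1) - (-1:ℚ)^(j+1))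

open scoped Classical in
/-- The quantity `Σ_{n,i}`. -/
noncomputable def SigmaNI (q n : ℕ) (i : ℤ) : ℚ :=
  if Odd ((n:ℤ) - i) then
    2*(q:ℚ)^(2*i+2) * muH q ((n:ℤ)-i-1)
      + 4 * muH q ((n:ℤ)-i-2) * ((q:ℚ)^((n:ℤ)-i-1) - 1)
          / ((q:ℚ)^((n:ℤ)-3*i-5) * ((q:ℚ)^2 - 1))
  else
    2*(q:ℚ)^(2*i+2) * (muH q ((n:ℤ)-i-1)
      + 2*((q:ℚ)^(4:ℤ) * muH q ((n:ℤ)-i-3) + (q:ℚ)^2 - 1)/((q:ℚ)^2 - 1))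

/-- `P` lies on a projective line entirely contained in the Hermitian variety that
meets both `π \ (π ⊓ π^σ)` and `π^σ \ (π ⊓ π^σ)`. -/
def OnGoodLine (q : ℕ) {F : Type} [Field F] {m : ℕ}
    (π P : Submodule F (Fin m → F)) : Prop :=
  ∃ A B : Submodule F (Fin m → F),
    Module.finrank F A = 1 ∧ A ≤ π ∧ ¬ A ≤ π ⊓ polar q π ∧
    Module.finrank F B = 1 ∧ B ≤ polar q π ∧ ¬ B ≤ π ⊓ polar q π ∧
    P ≤ A ⊔ B ∧ TotallyIsotropic q (A ⊔ B)

section aux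

variable {p hh q m : ℕ} {F : Type} [Field F] [Fintype F]

lemma pow_qq (hF : Fintype.card F = q ^ 2) (c : F) : (c ^ q) ^ q = c := by
  rw [← pow_mul, ← pow_two, ← hF, FiniteField.pow_card]

lemma q_add (hp : p.Prime) (hq : q = p ^ hh) (hF : Fintype.card F = q ^ 2) (a b : F) :
    (a + b) ^ q = a ^ q + b ^ q := by
  have : Fact p.Prime := ⟨hp⟩
  have : CharP F p := charP_of_card_eq_prime_pow (f := hh * 2) (by rw [hF, hq, pow_mul])
  rw [hq]
  exact add_pow_char_pow a b p hh

lemma herm_add_right (hp : p.Prime) (hq : q = p ^ hh) (hF : Fintype.card F = q ^ 2)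
    (x y z : Fin m → F) : herm q x (y + z) = herm q x y + herm q x z := by
  simp [herm, q_add hp hq hF, mul_add, Finset.sum_add_distrib]

lemma herm_add_left (x y z : Fin m → F) : herm q (x + y) z = herm q x z + herm q y z :=
  (hermL q z).map_add x y

lemma herm_smul_left (c : F) (x z : Fin m → F) : herm q (c • x) z = c * herm q x z :=
  (hermL q z).map_smul c x

lemma herm_smul_right (c : F) (x z : Fin m → F) : herm q x (c • z) = c ^ q * herm q x z := by
  simp only [herm, Finset.mul_sum, Pi.smul_apply, smul_eq_mul, mul_pow]
  exact Finset.sum_congr rfl fun i _ => by ring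

/-- `x ↦ h(·,x)` as an additive map. -/
def hermHom (hp : p.Prime) (hq : q = p ^ hh) (hF : Fintype.card F = q ^ 2) :
    (Fin m → F) →+ Module.Dual F (Fin m → F) :=
  AddMonoidHom.mk' (fun x => hermL q x) fun y z =>
    LinearMap.ext fun x => herm_add_right hp hq hF x y z

lemma hermHom_inj (hp : p.Prime) (hq : q = p ^ hh) (hF : Fintype.card F = q ^ 2) :
    Function.Injective (hermHom (m := m) hp hq hF) := by
  have hq0 : q ≠ 0 := by rw [hq]; exact pow_ne_zero _ hp.ne_zero
  rw [injective_iff_map_eq_zero]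
  intro x hx
  funext i
  have h : herm q (Pi.single i 1) x = 0 := LinearMap.congr_fun hx (Pi.single i 1)
  simp [herm, Pi.single_apply] at h
  exact h.1

lemma hermHom_smul (hp : p.Prime) (hq : q = p ^ hh) (hF : Fintype.card F = q ^ 2)
    (c : F) (x : Fin m → F) :
    hermHom hp hq hF (c • x) = c ^ q • hermHom hp hq hF x :=
  LinearMap.ext fun y => herm_smul_right c y x

/-- The image of `W` in the dual space. -/
def img (hp : p.Prime) (hq : q = p ^ hh) (hF : Fintype.card F = q ^ 2)
    (W : Submodule F (Fin m → F)) : Submodule F (Module.Dual F (Fin m → F)) where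
  __ := W.toAddSubgroup.map (hermHom hp hq hF)
  smul_mem' := by
    rintro c _ ⟨x, hx, rfl⟩
    refine ⟨c ^ q • x, W.smul_mem _ hx, ?_⟩
    rw [hermHom_smul, pow_qq hF]

lemma mem_polar (W : Submodule F (Fin m → F)) (y : Fin m → F) :
    y ∈ polar q W ↔ ∀ x ∈ W, herm q y x = 0 := by
  simp only [polar, Submodule.mem_iInf, LinearMap.mem_ker, Subtype.forall]
  rfl

lemma finrank_img (hp : p.Prime) (hq : q = p ^ hh) (hF : Fintype.card F = q ^ 2)
    (W : Submodule F (Fin m → F)) :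
    Module.finrank F (img hp hq hF W) = Module.finrank F W := by
  have hj : Function.Bijective (fun c : F => c ^ q) := by
    refine ⟨fun a b h => ?_, fun a => ⟨a ^ q, pow_qq hF a⟩⟩
    rw [← pow_qq hF a, ← pow_qq hF b]; exact congrArg (· ^ q) h
  have hq0 : q ≠ 0 := by rw [hq]; exact pow_ne_zero _ hp.ne_zero
  let e : W.toAddSubgroup ≃+ W.toAddSubgroup.map (hermHom hp hq hF) :=
    W.toAddSubgroup.equivMapOfInjective _ (hermHom_inj hp hq hF)
  let e' : W ≃+ img hp hq hF W := e
  unfold Module.finrank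
  refine congrArg Cardinal.toNat
    (rank_eq_of_equiv_equiv (⟨fun c : F => c ^ q, by simp [hq0]⟩ : ZeroHom F F)
      e' hj ?_).symm
  intro c x
  exact Subtype.ext (hermHom_smul hp hq hF c (x : Fin m → F))

lemma finrank_polar (hp : p.Prime) (hq : q = p ^ hh) (hF : Fintype.card F = q ^ 2)
    (W : Submodule F (Fin m → F)) :
    Module.finrank F W + Module.finrank F (polar q W) = m := by
  have h : polar q W = (img hp hq hF W).dualCoannihilator := by
    ext y
    rw [mem_polar, Submodule.mem_dualCoannihilator]
    constructor
    · rintro h _ ⟨x, hx, rfl⟩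
      exact h x hx
    · intro h x hx
      exact h _ ⟨x, hx, rfl⟩
  have := Subspace.finrank_add_finrank_dualCoannihilator_eq (img hp hq hF W)
  rw [finrank_img, ← h] at this
  simpa using this

lemma herm_symm (hp : p.Prime) (hq : q = p ^ hh) (hF : Fintype.card F = q ^ 2)
    (x y : Fin m → F) : herm q y x = herm q x y ^ q := by
  have : Fact p.Prime := ⟨hp⟩
  have : CharP F p := charP_of_card_eq_prime_pow (f := hh * 2) (by rw [hF, hq, pow_mul])
  have : herm q x y ^ q = ∑ i, (x i * (y i) ^ q) ^ q := by
    unfold herm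
    conv_lhs => rw [hq]
    rw [sum_pow_char_pow]
    simp only [hq]
  rw [this, herm]
  refine Finset.sum_congr rfl fun i _ => ?_
  rw [mul_pow, pow_qq hF, mul_comm]

lemma isotropic (hp : p.Prime) (hh1 : 1 ≤ hh) (hq : q = p ^ hh)
    (hF : Fintype.card F = q ^ 2) (W : Submodule F (Fin m → F))
    (hW : TotallyIsotropic q W) : W ≤ polar q W := by
  intro x hx
  rw [mem_polar]
  intro y hy
  by_contra ha
  have hq2 : 2 ≤ q := by
    rw [hq]; exact hp.two_le.trans (Nat.le_self_pow (by omega) p)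
  have key : ∀ d : F, d + d ^ q = 0 := by
    intro d
    set c := (d / herm q x y) with hc
    have h1 := hW (c • x + y) (W.add_mem (W.smul_mem _ hx) hy)
    rw [herm_add_left, herm_add_right hp hq hF, herm_add_right hp hq hF, hW y hy,
      herm_smul_left, herm_smul_left, herm_smul_right, herm_smul_right, hW x hx,
      herm_symm hp hq hF x y, ← mul_pow] at h1
    have h2 : c * herm q x y = d := div_mul_cancel₀ _ ha
    rw [h2] at h1
    simpa using h1
  have h1 := key 1
  rw [one_pow] at h1
  have h3 : ∀ x : Fˣ, x ^ (q - 1) = 1 := by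
    intro x
    have h4 : (x : F) ^ q = x := by
      linear_combination key x - (x : F) * h1
    ext
    have : (x : F) * x ^ (q - 1) = x * 1 := by
      rw [← pow_succ', Nat.sub_add_cancel (by omega), h4, mul_one]
    simpa using mul_left_cancel₀ x.ne_zero this
  rw [FiniteField.forall_pow_eq_one_iff, hF] at h3
  have h5 := Nat.le_of_dvd (by omega) h3
  have : q * 2 ≤ q ^ 2 := by rw [pow_two]; exact Nat.mul_le_mul_left _ hq2
  omega

end aux

/-- An `n`-space `π` and a generator `μ`: `π ∩ μ` and `π^σ ∩ μ` have the same
(projective) dimension. -/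
theorem stmt1 (n q p hh : ℕ) (hn : 1 ≤ n) (hp : p.Prime) (hh1 : 1 ≤ hh)
    (hq : q = p ^ hh)
    (F : Type) [Field F] [Fintype F] (hF : Fintype.card F = q ^ 2)
    (π μ : Submodule F (Fin (2*n+2) → F))
    (hπ : Module.finrank F π = n + 1) (hμ : IsGenerator q n μ) :
    Module.finrank F ↥(π ⊓ μ) = Module.finrank F ↥(polar q π ⊓ μ) := by
  obtain ⟨hμ1, hμ2⟩ := hμ
  have e1 := finrank_polar hp hq hF μ
  have hμμ : μ = polar q μ :=
    Submodule.eq_of_le_of_finrank_eq (isotropic hp hh1 hq hF μ hμ2) (by omega)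
  have e2 : polar q π ⊓ μ = polar q (π ⊔ μ) := by
    conv_lhs => rw [hμμ]
    ext y
    rw [Submodule.mem_inf, mem_polar, mem_polar, mem_polar]
    constructor
    · rintro ⟨h1, h2⟩ x hx
      obtain ⟨a, ha, b, hb, rfl⟩ := Submodule.mem_sup.1 hx
      rw [herm_add_right hp hq hF, h1 a ha, h2 b hb, add_zero]
    · intro h
      exact ⟨fun x hx => h x (Submodule.mem_sup_left hx),
        fun x hx => h x (Submodule.mem_sup_right hx)⟩
  rw [e2]
  have e3 := finrank_polar hp hq hF (π ⊔ μ)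
  have e4 := Submodule.finrank_sup_add_finrank_inf_eq π μ
  omega

end HermCode
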